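/- In ℝ² × ℝ², every point of the form ((0,0), v) with v ∈ ℝ² lies in the closure of the set S = { (p, t • p) : p ∈ ℝ², t ∈ ℝ }. Consequently the fiber over the origin of the closure of S is all of ℝ². -/

import Mathlib

open Filter Topology in
/-- In a topological vector space over `ℝ`, every `(0, v)` is the limit of the pairs
`((n + 1)⁻¹ • v, v)`, whose second component is a multiple of the first. -/
theorem zero_prod_mem_closure_smul_pairs {E : Type*} [AddCommGroup E] [Module ℝ E]
    [TopologicalSpace E] [ContinuousSMul ℝ E] (v : E) :
    ((0 : E), v) ∈ closure {q : E × E | ∃ (p : E) (t : ℝ), q = (p, t • p)} := by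
  have h : Tendsto (fun n : ℕ => ((1 / ((n : ℝ) + 1)) • v, v)) atTop (𝓝 ((0 : E), v)) := by
    refine Tendsto.prodMk_nhds ?_ tendsto_const_nhds
    simpa only [zero_smul] using
      (tendsto_one_div_add_atTop_nhds_zero_nat (𝕜 := ℝ)).smul_const v
  refine mem_closure_of_tendsto h (Eventually.of_forall fun n => ?_)
  refine ⟨(1 / ((n : ℝ) + 1)) • v, (n : ℝ) + 1, ?_⟩
  rw [smul_smul, mul_one_div_cancel (Nat.cast_add_one_ne_zero n), one_smul]

/-- Every point `((0,0), v)` of `ℝ² × ℝ²` lies in the closure of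
`S = {(p, t • p) : p ∈ ℝ², t ∈ ℝ}`; hence the fiber over the origin of the closure of `S`
is all of `ℝ²`. -/
theorem stmt_11 :
    (∀ v : ℝ × ℝ,
        (((0, 0) : ℝ × ℝ), v) ∈
          closure {q : (ℝ × ℝ) × (ℝ × ℝ) | ∃ (p : ℝ × ℝ) (t : ℝ), q = (p, t • p)}) ∧
      {v : ℝ × ℝ | (((0, 0) : ℝ × ℝ), v) ∈
          closure {q : (ℝ × ℝ) × (ℝ × ℝ) | ∃ (p : ℝ × ℝ) (t : ℝ), q = (p, t • p)}} =
        Set.univ := by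
  exact ⟨zero_prod_mem_closure_smul_pairs,
    Set.eq_univ_of_forall zero_prod_mem_closure_smul_pairs⟩
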